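/- For a Weyl system {W_z} on a separable Hilbert space, let S_ε denote the weak*-closed linear span of {W_z : |z| ≤ ε}. Then the intersection of S_ε over all ε > 0 equals ℂ·1. -/

import Mathlib

open MeasureTheory Complex Filter
open scoped ComplexOrder

noncomputable section

/-- The symplectic form `ω((x,y),(x',y')) = (x'y − xy')/2` on `ℝ²`. -/
def symp (z w : ℝ × ℝ) : ℝ := (w.1 * z.2 - z.1 * w.2) / 2

variable (H : Type) [NormedAddCommGroup H] [InnerProductSpace ℂ H] [CompleteSpace H]

/-- A Weyl system: a strongly continuous family of unitaries satisfying the Weyl relation. -/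
structure WeylSystem where
  W : ℝ × ℝ → H →L[ℂ] H
  unitary_mem : ∀ z, W z ∈ unitary (H →L[ℂ] H)
  strong_cont : ∀ f : H, Continuous fun z => W z f
  weyl : ∀ z₁ z₂, W z₁ * W z₂ = Complex.exp (Complex.I * (symp z₁ z₂ : ℂ)) • W (z₁ + z₂)

variable {H}

/-- Irreducibility: any operator commuting with all the `W z` is a scalar. -/
def WeylSystem.Irreducible (S : WeylSystem H) : Prop :=
  ∀ T : H →L[ℂ] H, (∀ z, T * S.W z = S.W z * T) → ∃ c : ℂ, T = c • (1 : H →L[ℂ] H)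

/-- Conjugation `A ↦ W_{ζ/√2} A W_{ζ/√2}*`. -/
def WeylSystem.conj (S : WeylSystem H) (ζ : ℝ × ℝ) (A : H →L[ℂ] H) : H →L[ℂ] H :=
  S.W ((Real.sqrt 2)⁻¹ • ζ) * A * star (S.W ((Real.sqrt 2)⁻¹ • ζ))

/-- Normal (weak-* continuous) linear functionals on `B(H)`. -/
def IsNormalFunctional (ρ : (H →L[ℂ] H) → ℂ) : Prop :=
  ∃ ξ η : ℕ → H, Summable (fun n => ‖ξ n‖ * ‖η n‖) ∧
    ∀ A : H →L[ℂ] H, ρ A = ∑' n, @inner ℂ _ _ (A (ξ n)) (η n)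

/-- Normal states on `B(H)`. -/
def IsNormalState (ρ : (H →L[ℂ] H) → ℂ) : Prop :=
  IsNormalFunctional ρ ∧ (∀ A : H →L[ℂ] H, 0 ≤ ρ (star A * A)) ∧ ρ 1 = 1

/-- The norm of a (bounded) linear functional on `B(H)`. -/
def funcNorm (ρ : (H →L[ℂ] H) → ℂ) : ℝ :=
  ⨆ A : {A : H →L[ℂ] H // ‖A‖ ≤ 1}, ‖ρ A.1‖

/-- The Gaussian probability measure `μ_t` on `ℝ²`, with density `(πt)⁻¹ e^{−(x²+y²)/(4t)}`,
whose symplectic Fourier transform is `e^{−t|z|²}`. -/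
def gaussMeasure (t : ℝ) : Measure (ℝ × ℝ) :=
  volume.withDensity fun p => ENNReal.ofReal ((Real.pi * t)⁻¹ * Real.exp (-(p.1 ^ 2 + p.2 ^ 2) / (4 * t)))

/-- `Φ` is the CCR heat flow semigroup: `Φ 0` is the identity and for `t > 0`, `Φ t` is given by
the weak integral `Φ t A = ∫ W_{ζ/√2} A W_{ζ/√2}* dμ_t(ζ)` against the Gaussian measure. -/
def IsHeatFlow (S : WeylSystem H) (Φ : ℝ → (H →L[ℂ] H) → (H →L[ℂ] H)) : Prop :=
  Φ 0 = id ∧ ∀ t > 0, ∀ (A : H →L[ℂ] H) (ξ η : H),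
    @inner ℂ _ _ ((Φ t A) ξ) η = ∫ ζ, @inner ℂ _ _ ((S.conj ζ A) ξ) η ∂(gaussMeasure t)

open scoped SchwartzMap FourierTransform

set_option linter.unusedSectionVars false

/-- The smooth cutoff `χ` modulated by the character `x ↦ e^{2πiax}`, as a Schwartz function. -/
def modulatedBump (χ : ContDiffBump (0 : ℝ)) (a : ℝ) : 𝓢(ℝ, ℂ) :=
  HasCompactSupport.toSchwartzMap (f := fun x : ℝ => cexp (2 * Real.pi * I * a * x) * (χ x : ℂ))
    ((χ.hasCompactSupport.comp_left (g := ((↑) : ℝ → ℂ)) ofReal_zero).mul_left)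
    (by
      have h : ContDiff ℝ (⊤ : ℕ∞) fun x : ℝ => ((χ x : ℝ) : ℂ) :=
        Complex.ofRealCLM.contDiff.comp χ.contDiff
      have h' : ContDiff ℝ (⊤ : ℕ∞) fun x : ℝ => (x : ℂ) := Complex.ofRealCLM.contDiff
      exact ((contDiff_const.mul h').cexp).mul h)

lemma modulatedBump_apply (χ : ContDiffBump (0 : ℝ)) (a x : ℝ) :
    modulatedBump χ a x = cexp (2 * Real.pi * I * a * x) * (χ x : ℂ) := rfl

lemma fourier_modulatedBump (χ : ContDiffBump (0 : ℝ)) (a y : ℝ) :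
    𝓕 (modulatedBump χ a) y = 𝓕 (modulatedBump χ 0) (y - a) := by
  rw [SchwartzMap.fourier_coe, SchwartzMap.fourier_coe, Real.fourier_real_eq_integral_exp_smul,
    Real.fourier_real_eq_integral_exp_smul]
  congr 1
  ext x
  simp only [modulatedBump_apply, smul_eq_mul, ← mul_assoc, ← Complex.exp_add]
  congr 2
  push_cast
  ring

lemma tsum_fourier_modulatedBump {χ : ContDiffBump (0 : ℝ)} (hχ : χ.rOut ≤ 1 / 2)
    {a x : ℝ} (hx : |x| ≤ χ.rIn) :
    ∑' k : ℤ, 𝓕 (modulatedBump χ a) (k : ℝ) * cexp (2 * Real.pi * I * k * x) =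
      cexp (2 * Real.pi * I * a * x) := by
  have h := (modulatedBump χ a).tsum_eq_tsum_fourier x
  rw [tsum_eq_single 0] at h
  · simp only [fourier_coe_apply, Int.cast_zero, add_zero, modulatedBump_apply, ofReal_one,
      div_one] at h
    rw [← h, χ.one_of_mem_closedBall (by simpa using hx)]
    simp
  · intro n hn
    have h1 : (1 : ℝ) ≤ |(n : ℝ)| := by exact_mod_cast Int.one_le_abs hn
    have h2 : |(n : ℝ)| ≤ |x + n| + |x| := by
      simpa using abs_sub (x + n) x
    have h3 := χ.rIn_lt_rOut
    rw [modulatedBump_apply, χ.zero_of_le_dist (by simp; linarith)]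
    simp

lemma summable_int_inv_sq_bound (C : ℝ) : Summable fun k : ℤ => C / (1 + (k : ℝ) ^ 2) := by
  refine Summable.mul_left C ?_
  refine Summable.of_norm_bounded_eventually
    (Real.summable_one_div_int_pow (p := 2).2 (by norm_num)) ?_
  rw [Filter.eventually_cofinite]
  refine (Set.finite_singleton (0 : ℤ)).subset fun k hk => ?_
  by_contra h
  refine hk ?_
  have hk0 : (0 : ℝ) < (k : ℝ) ^ 2 := by
    have : (k : ℝ) ≠ 0 := by exact_mod_cast h
    positivity
  rw [Real.norm_of_nonneg (by positivity), ← one_div]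
  exact one_div_le_one_div_of_le hk0 (by linarith)

lemma SchwartzMap.exists_shift_bound (f : 𝓢(ℝ, ℂ)) :
    ∃ C, ∀ a y : ℝ, |a| ≤ 1 → ‖f (y - a)‖ ≤ C / (1 + y ^ 2) := by
  obtain ⟨C₀, -, h0⟩ := f.decay 0 0
  obtain ⟨C₂, -, h2⟩ := f.decay 2 0
  refine ⟨3 * C₀ + 2 * C₂, fun a y ha => ?_⟩
  have h0' := h0 (y - a)
  have h2' := h2 (y - a)
  simp only [pow_zero, one_mul, norm_iteratedFDeriv_zero, Real.norm_eq_abs, sq_abs] at h0' h2'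
  rw [le_div_iff₀ (by positivity)]
  have hy : 1 + y ^ 2 ≤ 3 + 2 * (y - a) ^ 2 := by
    have := (sq_le_one_iff_abs_le_one a).2 ha
    nlinarith [sq_nonneg (y - 2 * a)]
  nlinarith [mul_le_mul_of_nonneg_left hy (norm_nonneg (f (y - a)))]

/-- The function `e^{iθ} - 1` agrees near `0` with periodic functions whose Fourier coefficients
have arbitrarily small `ℓ¹` norm. -/
theorem exists_small_absolutely_convergent_fourier {δ : ℝ} (hδ : 0 < δ) :
    ∃ a > (0 : ℝ), ∃ c : ℤ → ℂ, (Summable fun k => ‖c k‖) ∧ ∑' k, ‖c k‖ < δ ∧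
      ∀ θ : ℝ, |θ| ≤ a → ∑' k : ℤ, c k * cexp (I * ((k / a * θ : ℝ) : ℂ)) = cexp (I * θ) - 1 := by
  let χ : ContDiffBump (0 : ℝ) := ⟨1 / 4, 1 / 2, by norm_num, by norm_num⟩
  let F : 𝓢(ℝ, ℂ) := 𝓕 (modulatedBump χ 0)
  obtain ⟨C, hC⟩ := F.exists_shift_bound
  have hbd : ∀ a : ℝ, |a| ≤ 1 → ∀ k : ℤ, ‖F (k - a) - F k‖ ≤ (2 * C) / (1 + (k : ℝ) ^ 2) := by
    intro a ha k
    have h1 := hC a k ha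
    have h2 := hC 0 k (by simp)
    rw [sub_zero] at h2
    calc _ ≤ ‖F (k - a)‖ + ‖F k‖ := norm_sub_le _ _
      _ ≤ C / (1 + (k : ℝ) ^ 2) + C / (1 + (k : ℝ) ^ 2) := add_le_add h1 h2
      _ = _ := by ring
  have hsmall : ∀ᶠ a : ℝ in nhdsWithin 0 (Set.Ioi 0), |a| ≤ 1 := by
    filter_upwards [Ioo_mem_nhdsGT (zero_lt_one' ℝ)] with a ha
    rw [abs_of_pos ha.1]
    exact ha.2.le
  have hlim : Tendsto (fun a : ℝ => ∑' k : ℤ, ‖F (k - a) - F k‖) (nhdsWithin 0 (Set.Ioi 0))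
      (nhds (∑' _ : ℤ, (0 : ℝ))) := by
    refine tendsto_tsum_of_dominated_convergence (summable_int_inv_sq_bound (2 * C)) ?_ ?_
    · intro k
      have : Continuous fun a : ℝ => ‖F (k - a) - F k‖ := by
        have := F.continuous
        fun_prop
      have h := this.tendsto 0
      simp only [sub_zero, sub_self, norm_zero] at h
      exact h.mono_left nhdsWithin_le_nhds
    · filter_upwards [hsmall] with a ha k
      simpa using hbd a ha k
  rw [tsum_zero] at hlim
  obtain ⟨a, ha1, haδ, ha0⟩ :=
    (hsmall.and ((hlim.eventually_lt_const hδ).and self_mem_nhdsWithin)).exists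
  have ha0 : 0 < a := ha0
  refine ⟨a, ha0, fun k => F (k - a) - F k, ?_, haδ, fun θ hθ => ?_⟩
  · exact Summable.of_nonneg_of_le (fun _ => norm_nonneg _) (hbd a ha1)
      (summable_int_inv_sq_bound _)
  have hπ := Real.pi_gt_three
  have hx : |θ / (2 * Real.pi * a)| ≤ χ.rIn := by
    change _ ≤ (1 / 4 : ℝ)
    rw [abs_div, abs_of_pos (by positivity : 0 < 2 * Real.pi * a), div_le_iff₀ (by positivity)]
    nlinarith
  have key : ∀ b : ℝ, |b| ≤ 1 →
      HasSum (fun k : ℤ => F (k - b) * cexp (I * ((k / a * θ : ℝ) : ℂ)))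
        (cexp (2 * Real.pi * I * b * (θ / (2 * Real.pi * a) : ℝ))) := by
    intro b hb
    rw [← tsum_fourier_modulatedBump (χ := χ) le_rfl hx]
    have heq : ∀ k : ℤ, F (k - b) * cexp (I * ((k / a * θ : ℝ) : ℂ)) =
        𝓕 (modulatedBump χ b) (k : ℝ) *
          cexp (2 * Real.pi * I * k * (θ / (2 * Real.pi * a) : ℝ)) := by
      intro k
      rw [fourier_modulatedBump χ b]
      congr 2
      have : (a : ℂ) ≠ 0 := by exact_mod_cast ha0.ne'
      have : (Real.pi : ℂ) ≠ 0 := by exact_mod_cast Real.pi_ne_zero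
      push_cast
      field_simp
    simp only [← heq]
    refine Summable.hasSum (Summable.of_norm_bounded (summable_int_inv_sq_bound C) fun k => ?_)
    rw [norm_mul, mul_comm I, norm_exp_ofReal_mul_I, mul_one]
    exact hC b k hb
  have h1 := key a ha1
  have h0 := key 0 (by simp)
  rw [show 2 * Real.pi * I * a * ((θ / (2 * Real.pi * a) : ℝ) : ℂ) = I * θ by
    have : (a : ℂ) ≠ 0 := by exact_mod_cast ha0.ne'
    have : (Real.pi : ℂ) ≠ 0 := by exact_mod_cast Real.pi_ne_zero
    push_cast
    field_simp] at h1
  simp only [sub_zero, ofReal_zero, mul_zero, zero_mul, Complex.exp_zero] at h0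
  simpa only [sub_mul] using (h1.sub h0).tsum_eq

lemma isNormalFunctional_tsum {ι : Type*} [Denumerable ι] (ξ η : ι → H)
    (h : Summable fun i => ‖ξ i‖ * ‖η i‖) :
    IsNormalFunctional fun A : H →L[ℂ] H => ∑' i, inner ℂ (A (ξ i)) (η i) :=
  let e := (Denumerable.eqv ι).symm
  ⟨ξ ∘ e, η ∘ e, (e.summable_iff (f := fun i => ‖ξ i‖ * ‖η i‖)).2 h,
    fun A => (e.tsum_eq fun i => inner ℂ (A (ξ i)) (η i)).symm⟩

lemma summable_inner_apply {ι : Type*} {ξ η : ι → H} (h : Summable fun i => ‖ξ i‖ * ‖η i‖)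
    (A : H →L[ℂ] H) : Summable fun i => inner ℂ (A (ξ i)) (η i) := by
  refine Summable.of_norm_bounded (h.mul_left ‖A‖) fun i => ?_
  calc ‖inner ℂ (A (ξ i)) (η i)‖ ≤ ‖A (ξ i)‖ * ‖η i‖ := norm_inner_le_norm _ _
    _ ≤ ‖A‖ * ‖ξ i‖ * ‖η i‖ := by gcongr; exact A.le_opNorm _
    _ = _ := mul_assoc _ _ _

lemma isNormalFunctional_inner (ξ η : H) :
    IsNormalFunctional fun A : H →L[ℂ] H => inner ℂ (A ξ) η := by
  refine ⟨Pi.single 0 ξ, Pi.single 0 η, summable_of_ne_finset_zero (s := {0}) fun n hn => ?_,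
    fun A => ?_⟩
  · simp [Pi.single_eq_of_ne (Finset.notMem_singleton.1 hn)]
  · rw [tsum_eq_single 0 fun n hn => by simp [Pi.single_eq_of_ne hn]]
    simp

lemma IsNormalFunctional.const_mul {ρ : (H →L[ℂ] H) → ℂ} (hρ : IsNormalFunctional ρ) (c : ℂ) :
    IsNormalFunctional fun A => c * ρ A := by
  obtain ⟨ξ, η, h, hρ⟩ := hρ
  refine ⟨ξ, fun n => c • η n, ?_, fun A => ?_⟩
  · simpa only [norm_smul, mul_left_comm] using h.mul_left ‖c‖
  · simp only [hρ, inner_smul_right, tsum_mul_left]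

lemma IsNormalFunctional.add {ρ σ : (H →L[ℂ] H) → ℂ} (hρ : IsNormalFunctional ρ)
    (hσ : IsNormalFunctional σ) : IsNormalFunctional fun A => ρ A + σ A := by
  obtain ⟨ξ, η, h, hρ⟩ := hρ
  obtain ⟨ξ', η', h', hσ⟩ := hσ
  have hs : Summable fun i => ‖Sum.elim ξ ξ' i‖ * ‖Sum.elim η η' i‖ := by
    refine Summable.sum _ ?_ ?_
    · simpa [Function.comp_def] using h
    · simpa [Function.comp_def] using h'
  convert isNormalFunctional_tsum (Sum.elim ξ ξ') (Sum.elim η η') hs using 2 with A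
  rw [hρ, hσ, Summable.tsum_sum]
  · simp
  · simpa [Function.comp_def] using summable_inner_apply h A
  · simpa [Function.comp_def] using summable_inner_apply h' A

lemma IsNormalFunctional.sub {ρ σ : (H →L[ℂ] H) → ℂ} (hρ : IsNormalFunctional ρ)
    (hσ : IsNormalFunctional σ) : IsNormalFunctional fun A => ρ A - σ A := by
  simpa only [neg_one_mul, ← sub_eq_add_neg] using hρ.add (hσ.const_mul (-1))

namespace WeylSystem

lemma symp_swap (z w : ℝ × ℝ) : symp z w = -symp w z := by
  simp only [symp]; ring

lemma symp_smul_left (s : ℝ) (z w : ℝ × ℝ) : symp (s • z) w = s * symp z w := by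
  simp only [symp, Prod.smul_fst, Prod.smul_snd, smul_eq_mul]; ring

variable (S : WeylSystem H)

lemma inner_W_W (z : ℝ × ℝ) (ξ η : H) : inner ℂ (S.W z ξ) (S.W z η) = inner ℂ ξ η := by
  rw [← ContinuousLinearMap.adjoint_inner_left, ← ContinuousLinearMap.star_eq_adjoint,
    ← mul_apply_eq_comp, Unitary.star_mul_self_of_mem (S.unitary_mem z),
    one_apply_eq_self]

lemma norm_W (z : ℝ × ℝ) (ξ : H) : ‖S.W z ξ‖ = ‖ξ‖ := by
  rw [@norm_eq_sqrt_re_inner ℂ, @norm_eq_sqrt_re_inner ℂ, inner_W_W]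

lemma W_W (z w : ℝ × ℝ) (ξ : H) :
    S.W z (S.W w ξ) = cexp (I * (symp z w : ℂ)) • S.W (z + w) ξ := by
  rw [← mul_apply_eq_comp, S.weyl, smul_apply]

lemma W_zero : S.W 0 = 1 := by
  have h := S.weyl 0 0
  simp only [symp, Prod.fst_zero, Prod.snd_zero, mul_zero, sub_zero, zero_div, ofReal_zero,
    Complex.exp_zero, one_smul, add_zero] at h
  calc S.W 0 = star (S.W 0) * S.W 0 * S.W 0 := by
        rw [Unitary.star_mul_self_of_mem (S.unitary_mem 0), one_mul]
    _ = 1 := by rw [mul_assoc, h, Unitary.star_mul_self_of_mem (S.unitary_mem 0)]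

lemma W_comm (z w : ℝ × ℝ) (ξ : H) :
    S.W z (S.W w ξ) = cexp (I * ((2 * symp z w : ℝ) : ℂ)) • S.W w (S.W z ξ) := by
  rw [W_W, W_W, smul_smul, ← Complex.exp_add, add_comm w z, symp_swap w z]
  congr 2
  push_cast
  ring

lemma inner_W_conj (z w : ℝ × ℝ) (ξ η : H) :
    inner ℂ (S.W z (S.W w ξ)) (S.W w η) =
      cexp (I * ((2 * symp w z : ℝ) : ℂ)) * inner ℂ (S.W z ξ) η := by
  rw [W_comm, inner_smul_left, inner_W_W, ← Complex.exp_conj, map_mul, conj_I, conj_ofReal,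
    symp_swap z w]
  congr 2
  push_cast
  ring

/-- The elements of the intersection of the weak-*-closed spans `S_ε` of the `W_z`, `|z| ≤ ε`. -/
def MemSmallSpans (T : H →L[ℂ] H) : Prop :=
  ∀ ε > (0 : ℝ), ∀ ρ : (H →L[ℂ] H) → ℂ, IsNormalFunctional ρ →
    (∀ z : ℝ × ℝ, ‖z‖ ≤ ε → ρ (S.W z) = 0) → ρ T = 0

variable {S} {T : H →L[ℂ] H}

lemma exists_abs_symp_le (w : ℝ × ℝ) {a : ℝ} (ha : 0 < a) :
    ∃ ε > (0 : ℝ), ∀ z : ℝ × ℝ, ‖z‖ ≤ ε → |2 * symp w z| ≤ a := by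
  have hc : Continuous fun z : ℝ × ℝ => |2 * symp w z| := by
    unfold symp
    fun_prop
  have h0 : |2 * symp w 0| < a := by simpa [symp] using ha
  obtain ⟨ε, hε, h⟩ := Metric.eventually_nhds_iff_ball.1
    ((hc.tendsto 0).eventually_lt_const h0)
  refine ⟨ε / 2, by positivity, fun z hz => (h z ?_).le⟩
  rw [mem_ball_zero_iff]
  linarith

lemma MemSmallSpans.inner_conj (hT : S.MemSmallSpans T) (w : ℝ × ℝ) (ξ η : H) :
    inner ℂ (T (S.W w ξ)) (S.W w η) = inner ℂ (T ξ) η := by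
  rw [← sub_eq_zero, ← norm_le_zero_iff]
  refine le_of_forall_pos_le_add fun δ hδ => ?_
  set M := ‖T‖ * ‖ξ‖ * ‖η‖
  have hM0 : 0 ≤ M := by positivity
  obtain ⟨a, ha, c, hc, hcδ, hsum⟩ := exists_small_absolutely_convergent_fourier
    (δ := δ / (M + 1)) (by positivity)
  obtain ⟨ε, hε, hsymp⟩ := exists_abs_symp_le w ha
  let ξ' : ℤ → H := fun k => S.W ((k / a : ℝ) • w) ξ
  let η' : ℤ → H := fun k => c k • S.W ((k / a : ℝ) • w) η
  have hs : Summable fun k => ‖ξ' k‖ * ‖η' k‖ := by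
    simpa only [ξ', η', norm_smul, norm_W, mul_left_comm _ (‖c _‖)] using hc.mul_right (‖ξ‖ * ‖η‖)
  have key := hT ε hε _ (((isNormalFunctional_inner (S.W w ξ) (S.W w η)).sub
    (isNormalFunctional_inner ξ η)).sub (isNormalFunctional_tsum ξ' η' hs)) fun z hz => by
      simp only [ξ', η', inner_smul_right, inner_W_conj, symp_smul_left, ← mul_assoc,
        tsum_mul_right]
      have h := hsum _ (hsymp z hz)
      simp only [mul_left_comm _ (2 : ℝ), ← mul_assoc] at h ⊢
      rw [h]
      ring
  rw [sub_eq_zero] at key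
  rw [key, zero_add]
  calc ‖∑' k, inner ℂ (T (ξ' k)) (η' k)‖ ≤ ∑' k, ‖c k‖ * M := by
        refine tsum_of_norm_bounded (hc.mul_right M).hasSum fun k => ?_
        simp only [ξ', η', inner_smul_right, norm_mul]
        gcongr
        calc _ ≤ ‖T (S.W ((k / a : ℝ) • w) ξ)‖ * ‖S.W ((k / a : ℝ) • w) η‖ :=
              norm_inner_le_norm _ _
          _ ≤ ‖T‖ * ‖S.W ((k / a : ℝ) • w) ξ‖ * ‖S.W ((k / a : ℝ) • w) η‖ := by
              gcongr; exact T.le_opNorm _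
          _ = M := by rw [norm_W, norm_W]
    _ = (∑' k, ‖c k‖) * M := tsum_mul_right
    _ ≤ δ / (M + 1) * (M + 1) := by gcongr; linarith
    _ = δ := by field_simp

/-- An element of all the small spans commutes with the Weyl system. -/
theorem MemSmallSpans.commute (hT : S.MemSmallSpans T) (w : ℝ × ℝ) (ξ : H) :
    T (S.W w ξ) = S.W w (T ξ) := by
  refine ext_inner_right ℂ fun η => ?_
  have h : S.W w (star (S.W w) η) = η := by
    rw [← mul_apply_eq_comp, Unitary.mul_star_self_of_mem (S.unitary_mem w),
      one_apply_eq_self]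
  rw [← h, hT.inner_conj, inner_W_W]

/-- The Gaussian `e^{-|z|²/4}` on the complex plane. -/
def gaussWeight (z : ℂ) : ℂ := cexp (-(1 / 4 : ℂ) * ‖z‖ ^ 2)

lemma gaussWeight_eq (z : ℂ) : gaussWeight z = cexp (-((z.re ^ 2 + z.im ^ 2 : ℝ) : ℂ) / 4) := by
  rw [gaussWeight, ← ofReal_pow, Complex.sq_norm, Complex.normSq_apply]
  congr 1
  push_cast
  ring

lemma gaussWeight_neg (z : ℂ) : gaussWeight (-z) = gaussWeight z := by simp [gaussWeight]

lemma conj_gaussWeight (z : ℂ) : (starRingEnd ℂ) (gaussWeight z) = gaussWeight z := by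
  rw [gaussWeight_eq, ← Complex.exp_conj, map_div₀, map_neg, conj_ofReal, map_ofNat]

lemma continuous_gaussWeight : Continuous gaussWeight := by
  unfold gaussWeight
  fun_prop

lemma integrable_gaussWeight : Integrable gaussWeight := by
  have h := GaussianFourier.integrable_cexp_neg_mul_sq_norm_add (V := ℂ) (b := 1 / 4)
    (by norm_num) 0 0
  simp only [zero_mul, add_zero] at h
  exact h

/-- The form `symp` in the complex coordinate `x + iy`. -/
def sympC (z w : ℂ) : ℝ := (w.re * z.im - z.re * w.im) / 2

lemma integral_gaussWeight_mul_gaussWeight (v w : ℂ) :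
    ∫ y : ℂ, gaussWeight y * gaussWeight (v - w - y) *
        cexp (I * ((sympC w v + sympC y (w + v) : ℝ) : ℂ)) =
      2 * Real.pi * gaussWeight w * gaussWeight v := by
  have h := GaussianFourier.integral_cexp_neg_mul_sq_norm_add (V := ℂ) (b := 1 / 2)
    (by norm_num) (I / 2) (I * (w + v))
  rw [← integral_add_right_eq_self _ ((v - w) / 2)]
  have hpt : ∀ x : ℂ, gaussWeight (x + (v - w) / 2) * gaussWeight (v - w - (x + (v - w) / 2)) *
        cexp (I * ((sympC w v + sympC (x + (v - w) / 2) (w + v) : ℝ) : ℂ)) =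
      cexp (-(((v - w).re ^ 2 + (v - w).im ^ 2 : ℝ) : ℂ) / 8) *
        cexp (-(1 / 2) * ‖x‖ ^ 2 + I / 2 * (inner ℝ (I * (w + v)) x : ℝ)) := by
    intro x
    have e1 : ((‖x‖ : ℂ)) ^ 2 = ((x.re ^ 2 + x.im ^ 2 : ℝ) : ℂ) := by
      rw [← ofReal_pow, Complex.sq_norm, Complex.normSq_apply]
      congr 1
      ring
    have e2 : inner ℝ (I * (w + v)) x = -(w + v).im * x.re + (w + v).re * x.im := by
      rw [Complex.inner]
      simp
      ring
    rw [gaussWeight_eq, gaussWeight_eq, ← Complex.exp_add, ← Complex.exp_add, ← Complex.exp_add,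
      e1, e2]
    congr 1
    simp only [sympC, add_re, add_im, sub_re, sub_im, div_ofNat_re, div_ofNat_im]
    push_cast
    ring
  simp only [hpt]
  rw [integral_const_mul, h, gaussWeight_eq, gaussWeight_eq]
  have e3 : ((‖I * (w + v)‖ : ℂ)) ^ 2 = (((w + v).re ^ 2 + (w + v).im ^ 2 : ℝ) : ℂ) := by
    rw [norm_mul, norm_I, one_mul, ← ofReal_pow, Complex.sq_norm, Complex.normSq_apply]
    congr 1
    ring
  rw [e3, Complex.finrank_real_complex, Nat.cast_ofNat, div_self (two_ne_zero' ℂ), cpow_one,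
    mul_left_comm, ← Complex.exp_add, mul_assoc, ← Complex.exp_add]
  congr 1
  · ring
  · congr 1
    simp only [add_re, add_im, sub_re, sub_im, div_pow, I_sq]
    push_cast
    ring

section ComplexCoordinate

variable (S)

/-- The Weyl system indexed by the complex coordinate `x + iy`. -/
def V (z : ℂ) : H →L[ℂ] H := S.W (z.re, z.im)

lemma V_V (z w : ℂ) (ξ : H) : S.V z (S.V w ξ) = cexp (I * (sympC z w : ℂ)) • S.V (z + w) ξ :=
  S.W_W _ _ ξ

lemma V_zero (ξ : H) : S.V 0 ξ = ξ := by
  change S.W 0 ξ = ξ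
  rw [W_zero, one_apply_eq_self]

lemma norm_V (z : ℂ) (ξ : H) : ‖S.V z ξ‖ = ‖ξ‖ := S.norm_W _ ξ

lemma continuous_V (ξ : H) : Continuous fun z => S.V z ξ :=
  (S.strong_cont ξ).comp (by fun_prop : Continuous fun z : ℂ => (z.re, z.im))

lemma V_neg_V (z : ℂ) (ξ : H) : S.V (-z) (S.V z ξ) = ξ := by
  rw [V_V, neg_add_cancel, V_zero]
  have : sympC (-z) z = 0 := by simp only [sympC, neg_re, neg_im]; ring
  simp [this]

lemma inner_V_left (z : ℂ) (ξ η : H) : inner ℂ (S.V z ξ) η = inner ℂ ξ (S.V (-z) η) := by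
  conv_rhs => rw [← S.V_neg_V z ξ]
  exact (S.inner_W_W _ _ _).symm

lemma integrable_gaussWeight_smul_V (ξ : H) : Integrable fun z => gaussWeight z • S.V z ξ := by
  refine (integrable_gaussWeight.norm.mul_const ‖ξ‖).mono'
    (continuous_gaussWeight.smul (S.continuous_V ξ)).aestronglyMeasurable (ae_of_all _ fun z => ?_)
  rw [norm_smul, norm_V]

/-- The Gaussian average `∫ e^{-|z|²/4} W_z ξ dz`: up to the factor `2π`, the projection onto the
vacuum vectors. -/
def gaussAvg (ξ : H) : H := ∫ z : ℂ, gaussWeight z • S.V z ξ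

lemma inner_gaussAvg_left (ξ η : H) :
    inner ℂ (S.gaussAvg ξ) η = inner ℂ ξ (S.gaussAvg η) := by
  rw [gaussAvg, gaussAvg, ← inner_conj_symm, ← integral_inner (S.integrable_gaussWeight_smul_V ξ),
    ← integral_inner (S.integrable_gaussWeight_smul_V η), ← integral_conj,
    ← integral_neg_eq_self]
  congr 1
  ext z
  rw [inner_conj_symm, inner_smul_left, inner_smul_right, conj_gaussWeight, gaussWeight_neg,
    inner_V_left, neg_neg]

lemma map_gaussAvg {A : H →L[ℂ] H} (hA : ∀ z ξ, A (S.V z ξ) = S.V z (A ξ)) (ξ : H) :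
    A (S.gaussAvg ξ) = S.gaussAvg (A ξ) := by
  rw [gaussAvg, ← A.integral_comp_comm (S.integrable_gaussWeight_smul_V ξ), gaussAvg]
  simp only [map_smul, hA]

lemma gaussAvg_V_gaussAvg (w : ℂ) (ξ : H) :
    S.gaussAvg (S.V w (S.gaussAvg ξ)) = (2 * Real.pi * gaussWeight w) • S.gaussAvg ξ := by
  let F : ℂ → ℂ → H := fun y v => (gaussWeight y * gaussWeight (v - w - y) *
    cexp (I * ((sympC w v + sympC y (w + v) : ℝ) : ℂ))) • S.V v ξ
  have hF : Integrable (Function.uncurry F) (volume.prod volume) := by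
    have h := (integrable_gaussWeight.convolution_integrand (ContinuousLinearMap.mul ℂ ℂ)
      (integrable_gaussWeight.comp_sub_right w)).swap.norm.mul_const ‖ξ‖
    refine h.mono' ?_ (ae_of_all _ fun p => ?_)
    · refine Continuous.aestronglyMeasurable ?_
      have h1 := continuous_gaussWeight
      have h2 := S.continuous_V ξ
      simp only [F, Function.uncurry_def, sympC]
      fun_prop
    · simp only [Function.uncurry_def, F, norm_smul, norm_V, norm_mul, mul_comm I,
        norm_exp_ofReal_mul_I, mul_one, Function.comp_apply, Prod.fst_swap, Prod.snd_swap,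
        ContinuousLinearMap.mul_apply', sub_right_comm]
      exact le_rfl
  have hinner : ∀ y : ℂ, gaussWeight y • S.V y (S.V w (S.gaussAvg ξ)) = ∫ v, F y v := by
    intro y
    rw [gaussAvg, ← (S.V w).integral_comp_comm (S.integrable_gaussWeight_smul_V ξ),
      ← (S.V y).integral_comp_comm ((S.V w).integrable_comp (S.integrable_gaussWeight_smul_V ξ)),
      ← integral_smul, ← integral_sub_right_eq_self _ (w + y)]
    congr 1
    ext v
    simp only [map_smul, V_V, smul_smul, F]
    have e : y + (w + (v - (w + y))) = v := by ring
    rw [e, sub_sub]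
    congr 1
    simp only [mul_assoc, ← Complex.exp_add]
    congr 3
    simp only [sympC, add_re, add_im, sub_re, sub_im]
    push_cast
    ring
  rw [gaussAvg]
  simp only [hinner]
  rw [integral_integral_swap hF, gaussAvg, ← integral_smul]
  congr 1
  ext v
  rw [integral_smul_const, integral_gaussWeight_mul_gaussWeight, smul_smul]

lemma inner_V_gaussAvg (w : ℂ) (ξ η : H) :
    inner ℂ (S.V w (S.gaussAvg ξ)) (S.gaussAvg η) =
      2 * Real.pi * gaussWeight w * inner ℂ (S.gaussAvg ξ) η := by
  rw [← inner_gaussAvg_left, gaussAvg_V_gaussAvg, inner_smul_left, map_mul, map_mul, map_ofNat, conj_ofReal,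
    conj_gaussWeight]

/-- A vector all of whose translates have vanishing Gaussian average is zero. -/
lemma eq_zero_of_gaussAvg_V_eq_zero {ξ : H} (h : ∀ z, S.gaussAvg (S.V z ξ) = 0) : ξ = 0 := by
  let f : ℂ → H := fun v => gaussWeight v • S.V v ξ
  have hf : Continuous f := continuous_gaussWeight.smul (S.continuous_V ξ)
  have h0 : 𝓕 f = 0 := by
    ext x
    have hx := congrArg (S.V (-(2 * Real.pi * I * x))) (h (2 * Real.pi * I * x))
    rw [gaussAvg, map_zero, ← ContinuousLinearMap.integral_comp_comm _
      (S.integrable_gaussWeight_smul_V _)] at hx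
    rw [Real.fourier_eq', Pi.zero_apply, ← hx]
    congr 1
    ext v
    simp only [map_smul, V_V, smul_smul, f]
    have e : -(2 * Real.pi * I * x) + (v + 2 * Real.pi * I * x) = v := by ring
    rw [e, mul_comm (cexp _) (gaussWeight v), mul_assoc (gaussWeight v), ← Complex.exp_add]
    congr 3
    simp only [sympC, Complex.inner]
    simp
    ring
  have hinv := congrFun (hf.fourierInv_fourier_eq (S.integrable_gaussWeight_smul_V ξ)
    (by rw [h0]; exact integrable_zero _ _ _)) 0
  rw [h0] at hinv
  simpa [f, V_zero, gaussWeight, Real.fourierInv_eq'] using hinv.symm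

end ComplexCoordinate

/-- An element of all the small spans is a scalar. -/
theorem MemSmallSpans.exists_eq_smul_one (hT : S.MemSmallSpans T) :
    ∃ c : ℂ, T = c • (1 : H →L[ℂ] H) := by
  by_cases hP : ∀ ξ, S.gaussAvg ξ = 0
  · refine ⟨0, ?_⟩
    ext ξ
    rw [S.eq_zero_of_gaussAvg_V_eq_zero (ξ := ξ) fun z => hP _]
    simp
  push Not at hP
  obtain ⟨ζ, hζ⟩ := hP
  have hV0 : ∀ ξ η : H, inner ℂ (S.gaussAvg ξ) (S.gaussAvg η) =
      2 * Real.pi * inner ℂ (S.gaussAvg ξ) η := fun ξ η => by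
    simpa [V_zero, gaussWeight] using S.inner_V_gaussAvg 0 ξ η
  set b := inner ℂ (S.gaussAvg ζ) ζ
  have hb : b ≠ 0 := by
    intro hb
    refine hζ (inner_self_eq_zero (𝕜 := ℂ).1 ?_)
    rw [hV0, show inner ℂ (S.gaussAvg ζ) ζ = 0 from hb, mul_zero]
  set c := (starRingEnd ℂ) (inner ℂ (T (S.gaussAvg ζ)) (S.gaussAvg ζ) / (2 * Real.pi * b)) with hc
  have hvac : ∀ ξ η : H, inner ℂ (T (S.gaussAvg ξ)) (S.gaussAvg η) =
      (starRingEnd ℂ) c * inner ℂ (S.gaussAvg ξ) (S.gaussAvg η) := by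
    intro ξ η
    have key := hT 1 one_pos _
      (((isNormalFunctional_inner (S.gaussAvg ξ) (S.gaussAvg η)).const_mul b).sub
        ((isNormalFunctional_inner (S.gaussAvg ζ) (S.gaussAvg ζ)).const_mul
          (inner ℂ (S.gaussAvg ξ) η))) fun z _ => by
        have h1 := S.inner_V_gaussAvg ⟨z.1, z.2⟩ ξ η
        have h2 := S.inner_V_gaussAvg ⟨z.1, z.2⟩ ζ ζ
        simp only [V] at h1 h2
        rw [h1, h2]
        ring
    rw [hc, conj_conj, hV0]
    field_simp
    linear_combination key
  refine ⟨c, ?_⟩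
  have hD : ∀ z ξ, (T - c • 1) (S.V z ξ) = S.V z ((T - c • 1) ξ) := by
    intro z ξ
    have := hT.commute (z.re, z.im) ξ
    simp [V, this]
  rw [← sub_eq_zero]
  ext ξ
  refine S.eq_zero_of_gaussAvg_V_eq_zero fun z => ?_
  rw [← hD, ← inner_self_eq_zero (𝕜 := ℂ)]
  nth_rewrite 1 [← S.map_gaussAvg hD]
  rw [sub_apply, inner_sub_left, hvac, smul_apply, inner_smul_left, one_apply_eq_self, sub_self]

end WeylSystem

/-- For a Weyl system on a separable Hilbert space, the intersection over all
`ε > 0` of the weak-*-closed linear spans `S_ε` of `{W_z : |z| ≤ ε}` is `ℂ·1`.  (Membership of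
`T` in the weak-*-closed span is expressed, via the bipolar theorem, as: every normal functional
vanishing on all `W_z` with `|z| ≤ ε` vanishes at `T`.) -/
theorem weyl_small_spans_intersection [TopologicalSpace.SeparableSpace H]
    (S : WeylSystem H) (T : H →L[ℂ] H) :
    (∀ ε > (0 : ℝ), ∀ ρ : (H →L[ℂ] H) → ℂ, IsNormalFunctional ρ →
        (∀ z : ℝ × ℝ, ‖z‖ ≤ ε → ρ (S.W z) = 0) → ρ T = 0) ↔
      ∃ c : ℂ, T = c • (1 : H →L[ℂ] H) := by
  refine ⟨fun hT => WeylSystem.MemSmallSpans.exists_eq_smul_one (S := S) hT, ?_⟩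
  rintro ⟨c, rfl⟩ ε hε ρ ⟨ξ, η, -, hρ⟩ hW
  have h1 := hW 0 (by simpa using hε.le)
  rw [S.W_zero, hρ] at h1
  rw [hρ]
  simp only [smul_apply, inner_smul_left, tsum_mul_left, h1, mul_zero]
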